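/- Let m ∈ (1,2] and let u ∈ {0,1}^ℕ contain at least two ones. Then max(f_u(m), g_u(m)) ≥ 2. -/

import Mathlib

/-- `π_β(u)` for a binary sequence `u = u₁u₂⋯` (indexed from 0). -/
noncomputable def piB (β : ℝ) (u : ℕ → Bool) : ℝ :=
  ∑' k : ℕ, (if u k then (1 : ℝ) else 0) / β ^ (k + 1)

/-- `π_β(u)` for a real digit sequence. -/
noncomputable def piR (β : ℝ) (u : ℕ → ℝ) : ℝ := ∑' k : ℕ, u k / β ^ (k + 1)

/-- A binary sequence viewed as a real digit sequence. -/
def bR (u : ℕ → Bool) : ℕ → ℝ := fun k => if u k then 1 else 0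

/-- `U_β(A)`: sequences with digits in `A` whose `π_β`-value has no other expansion over `A`. -/
def Uset (β : ℝ) (A : Set ℝ) : Set (ℕ → ℝ) :=
  {u | (∀ k, u k ∈ A) ∧ ∀ v : ℕ → ℝ, (∀ k, v k ∈ A) → v ≠ u → piR β v ≠ piR β u}

/-- `𝓛(m) = inf {β > 1 : U_β(m) ∩ {0,1}^ℕ is uncountable}`. -/
noncomputable def Lval (m : ℝ) : ℝ :=
  sInf {β : ℝ | 1 < β ∧ ¬ (Uset β {0, 1, m} ∩ {v | ∃ u : ℕ → Bool, v = bR u}).Countable}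

/-- The shift orbit `O(u)` of an infinite binary word. -/
def orbit (u : ℕ → Bool) : Set (ℕ → Bool) := {v | ∃ k : ℕ, v = fun i => u (i + k)}

/-- Suffixes of `u` preceded by the letter `1`. -/
def orbit1 (u : ℕ → Bool) : Set (ℕ → Bool) :=
  {v | ∃ k : ℕ, u k = true ∧ v = fun i => u (i + k + 1)}

/-- Suffixes of `u` preceded by the letter `0`. -/
def orbit0 (u : ℕ → Bool) : Set (ℕ → Bool) :=
  {v | ∃ k : ℕ, u k = false ∧ v = fun i => u (i + k + 1)}

open Classical in
/-- The lexicographic supremum of a set of binary sequences (greedy construction);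
`⊥ = 0̄` for the empty set. -/
noncomputable def lexSupSeq (S : Set (ℕ → Bool)) : ℕ → Bool
  | n => decide (∃ u ∈ S, (∀ i, i < n → u i = lexSupSeq S i) ∧ u n = true)
  termination_by n => n

open Classical in
/-- The lexicographic infimum of a set of binary sequences (greedy construction);
`⊤ = 1̄` for the empty set. -/
noncomputable def lexInfSeq (S : Set (ℕ → Bool)) : ℕ → Bool
  | n => decide (¬ ∃ u ∈ S, (∀ i, i < n → u i = lexInfSeq S i) ∧ u n = false)
  termination_by n => n

/-- `sup O(u)`, the lexicographically largest limit of suffixes of `u`. -/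
noncomputable def supO (u : ℕ → Bool) : ℕ → Bool := lexSupSeq (orbit u)
/-- `inf O(u)`. -/
noncomputable def infO (u : ℕ → Bool) : ℕ → Bool := lexInfSeq (orbit u)
/-- `sup₀(u)`, the supremum of the suffixes preceded by `0`. -/
noncomputable def sup0 (u : ℕ → Bool) : ℕ → Bool := lexSupSeq (orbit0 u)
/-- `inf₁(u)`, the infimum of the suffixes preceded by `1`. -/
noncomputable def inf1 (u : ℕ → Bool) : ℕ → Bool := lexInfSeq (orbit1 u)

/-- Strict lexicographic order on infinite binary words. -/
def lexLt (u v : ℕ → Bool) : Prop := ∃ n, (∀ i, i < n → u i = v i) ∧ u n < v n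
/-- Lexicographic order on infinite binary words. -/
def lexLe (u v : ℕ → Bool) : Prop := lexLt u v ∨ u = v

/-- `f_u(m)`: the unique `β ≥ 1` with `β·π_β(sup O(u)) = m`. -/
noncomputable def fVal (u : ℕ → Bool) (m : ℝ) : ℝ :=
  sInf {β : ℝ | 1 ≤ β ∧ β * piB β (supO u) = m}

/-- `g_u(m)`: the unique `β > 1` with `(β-1)(1+π_β(inf O(u))) = m`. -/
noncomputable def gVal (u : ℕ → Bool) (m : ℝ) : ℝ :=
  sInf {β : ℝ | 1 < β ∧ (β - 1) * (1 + piB β (infO u)) = m}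

/-- `μ_u`: the unique `m ∈ (1,2]` with `f_u(m) = g_u(m)`. -/
noncomputable def muVal (u : ℕ → Bool) : ℝ :=
  sInf {m : ℝ | 1 < m ∧ m ≤ 2 ∧ fVal u m = gVal u m}

/-- `u` contains at least two ones. -/
def TwoOnes (u : ℕ → Bool) : Prop := ∃ k l, k < l ∧ u k = true ∧ u l = true

/-- The substitution `L : 0 ↦ 0, 1 ↦ 01` (with `0 = false`, `1 = true`). -/
def Lsub : Bool → List Bool := fun b => if b then [false, true] else [false]
/-- The substitution `M : 0 ↦ 01, 1 ↦ 10`. -/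
def Msub : Bool → List Bool := fun b => if b then [true, false] else [false, true]
/-- The substitution `R : 0 ↦ 01, 1 ↦ 1`. -/
def Rsub : Bool → List Bool := fun b => if b then [true] else [false, true]
/-- The identity substitution. -/
def idSub : Bool → List Bool := fun b => [b]
/-- Composition of substitutions: `compSub σ τ = σ ∘ τ` (apply `τ` first). -/
def compSub (σ τ : Bool → List Bool) : Bool → List Bool := fun b => (τ b).flatMap σ

/-- The monoid `{L,M,R}*` generated by the three substitutions. -/
def LMRstar : Set (Bool → List Bool) :=
  {σ | ∃ l : List (Bool → List Bool),
    (∀ τ ∈ l, τ = Lsub ∨ τ = Msub ∨ τ = Rsub) ∧ σ = l.foldr compSub idSub}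

/-- A substitution applied to an infinite word, `σ(u₁)σ(u₂)⋯`. -/
noncomputable def substApply (σ : Bool → List Bool) (u : ℕ → Bool) : ℕ → Bool := fun n =>
  let k := sSup {k : ℕ | (∑ i ∈ Finset.range k, (σ (u i)).length) ≤ n}
  (σ (u k)).getD (n - ∑ i ∈ Finset.range k, (σ (u i)).length) false

/-- `u` is a limit word of the sequence of substitutions `σseq`. -/
def IsLimitWord (σseq : ℕ → Bool → List Bool) (u : ℕ → Bool) : Prop :=
  ∃ useq : ℕ → ℕ → Bool, useq 0 = u ∧ ∀ n, useq n = substApply (σseq n) (useq (n + 1))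

/-- Primitivity of a sequence of substitutions in `{L,M,R}^ℕ`: no tail is constantly `L`
and no tail is constantly `R`. -/
def PrimitiveSeq (σseq : ℕ → Bool → List Bool) : Prop :=
  (¬ ∃ k, ∀ n, k ≤ n → σseq n = Lsub) ∧ ¬ ∃ k, ∀ n, k ≤ n → σseq n = Rsub

/-- `S_{L,M,R}`: the set of limit words of primitive sequences of substitutions. -/
def Sset : Set (ℕ → Bool) :=
  {u | ∃ σseq : ℕ → Bool → List Bool,
    (∀ n, σseq n = Lsub ∨ σseq n = Msub ∨ σseq n = Rsub) ∧
    PrimitiveSeq σseq ∧ IsLimitWord σseq u}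

/-- The word `1 0̄ = 1000⋯`. -/
def w10bar : ℕ → Bool := fun n => decide (n = 0)
/-- The word `0 1̄ = 0111⋯`. -/
def w01bar : ℕ → Bool := fun n => decide (n ≠ 0)
/-- The word `01 0̄ = 01000⋯`. -/
def w010bar : ℕ → Bool := fun n => decide (n = 1)
/-- The word `10 1̄ = 10111⋯`. -/
def w101bar : ℕ → Bool := fun n => decide (n ≠ 1)
/-- The word `0̄`. -/
def w0bar : ℕ → Bool := fun _ => false
/-- The word `1̄`. -/
def w1bar : ℕ → Bool := fun _ => true

/-- Prepend a letter to an infinite word. -/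
def consB (b : Bool) (u : ℕ → Bool) : ℕ → Bool := fun n =>
  match n with
  | 0 => b
  | Nat.succ k => u k

/-- Prepend a finite word to an infinite word. -/
def appendW (w : List Bool) (v : ℕ → Bool) : ℕ → Bool := fun n =>
  if n < w.length then w.getD n false else v (n - w.length)

theorem summable_piB_terms {β : ℝ} (hβ : 1 < β) (u : ℕ → Bool) :
    Summable fun k : ℕ => (if u k then (1 : ℝ) else 0) / β ^ (k + 1) := by
  have hgeom : Summable fun k : ℕ => (1 / β) ^ (k + 1) :=
    (summable_nat_add_iff 1).2
      (summable_geometric_of_lt_one (by positivity) ((div_lt_one (by linarith)).2 hβ))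
  refine Summable.of_nonneg_of_le (fun k => ?_) (fun k => ?_) hgeom
  · split_ifs <;> positivity
  · rw [one_div_pow]
    split_ifs
    · exact le_rfl
    · rw [zero_div]; positivity

theorem piB_nonneg {β : ℝ} (hβ : 0 < β) (u : ℕ → Bool) : 0 ≤ piB β u :=
  tsum_nonneg fun k => by split_ifs <;> positivity

theorem piB_le {β : ℝ} (hβ : 1 < β) (u : ℕ → Bool) : piB β u ≤ 1 / (β - 1) := by
  have hlt : 1 / β < 1 := (div_lt_one (by linarith)).2 hβ
  have hgeom : HasSum (fun k : ℕ => 1 / β ^ (k + 1)) (1 / (β - 1)) := by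
    have h := (hasSum_geometric_of_lt_one (r := 1 / β) (by positivity) hlt).mul_right (1 / β)
    have e : (1 - 1 / β)⁻¹ * (1 / β) = 1 / (β - 1) := by
      have : β - 1 ≠ 0 := by linarith
      have : β ≠ 0 := by linarith
      field_simp
    rw [e] at h
    have hfun : (fun k : ℕ => 1 / β ^ (k + 1)) = fun k => (1 / β) ^ k * (1 / β) :=
      funext fun k => by rw [← pow_succ, one_div_pow]
    rwa [hfun]
  refine hasSum_le (fun k => ?_) (summable_piB_terms hβ u).hasSum hgeom
  split_ifs
  · exact le_rfl
  · rw [zero_div]; positivity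

theorem continuousOn_piB (u : ℕ → Bool) : ContinuousOn (fun β => piB β u) (Set.Ici 2) := by
  refine continuousOn_tsum (u := fun k : ℕ => (1 / 2 : ℝ) ^ (k + 1)) (fun k => ?_)
    ((summable_nat_add_iff 1).2 summable_geometric_two) fun k β hβ => ?_
  · refine continuousOn_const.div (continuousOn_id.pow _) fun β hβ => ?_
    have : (2 : ℝ) ≤ β := hβ
    exact pow_ne_zero _ (by linarith : β ≠ 0)
  · have hβ' : (2 : ℝ) ≤ β := hβ
    have h1 : 1 / β ^ (k + 1) ≤ (1 / 2 : ℝ) ^ (k + 1) := by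
      rw [one_div_pow]
      exact one_div_le_one_div_of_le (by positivity) (by gcongr)
    have h2 : 0 < β ^ (k + 1) := by positivity
    rw [Real.norm_of_nonneg (by split_ifs <;> positivity)]
    split_ifs
    · exact h1
    · rw [zero_div]; positivity

/-- Every prefix of the lexicographic supremum is a prefix of an element of the set. -/
theorem exists_mem_prefix_lexSupSeq {S : Set (ℕ → Bool)} (hS : S.Nonempty) (n : ℕ) :
    ∃ v ∈ S, ∀ i, i < n → v i = lexSupSeq S i := by
  induction n with
  | zero => exact ⟨hS.some, hS.some_mem, fun i hi => absurd hi (Nat.not_lt_zero i)⟩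
  | succ n ih =>
    have key : lexSupSeq S n = true ↔
        ∃ v ∈ S, (∀ i, i < n → v i = lexSupSeq S i) ∧ v n = true := by
      classical
      rw [lexSupSeq]
      exact decide_eq_true_iff
    obtain ⟨v, hv, hvn⟩ : ∃ v ∈ S, (∀ i, i < n → v i = lexSupSeq S i) ∧ v n = lexSupSeq S n := by
      cases hs : lexSupSeq S n with
      | true => exact key.1 hs
      | false =>
        obtain ⟨v, hv, hvn⟩ := ih
        refine ⟨v, hv, hvn, ?_⟩
        by_contra h
        rw [key.2 ⟨v, hv, hvn, by simpa using h⟩] at hs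
        exact absurd hs (by decide)
    refine ⟨v, hv, fun i hi => ?_⟩
    rcases Nat.lt_succ_iff_lt_or_eq.1 hi with h | rfl
    · exact hvn.1 i h
    · exact hvn.2

theorem lexSupSeq_eq_true {S : Set (ℕ → Bool)} {v : ℕ → Bool} (hv : v ∈ S) {n : ℕ}
    (h : ∀ i, i < n → v i = lexSupSeq S i) (hn : v n = true) : lexSupSeq S n = true := by
  classical
  rw [lexSupSeq]
  exact decide_eq_true ⟨v, hv, h, hn⟩

theorem lexInfSeq_eq_false {S : Set (ℕ → Bool)} {v : ℕ → Bool} (hv : v ∈ S) {n : ℕ}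
    (h : ∀ i, i < n → v i = lexInfSeq S i) (hn : v n = false) : lexInfSeq S n = false := by
  classical
  rw [lexInfSeq]
  exact decide_eq_false (not_not_intro ⟨v, hv, h, hn⟩)

theorem supO_zero {u : ℕ → Bool} (hu : TwoOnes u) : supO u 0 = true := by
  obtain ⟨k, l, -, hk, -⟩ := hu
  exact lexSupSeq_eq_true (S := orbit u) (v := fun i => u (i + k)) ⟨k, rfl⟩
    (fun i hi => absurd hi (Nat.not_lt_zero i)) (by simpa using hk)

theorem exists_pos_supO {u : ℕ → Bool} (hu : TwoOnes u) : ∃ j, 0 < j ∧ supO u j = true := by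
  have h0 := supO_zero hu
  obtain ⟨k, l, hkl, hk, hl⟩ := hu
  by_contra! hcon
  have hagree : ∀ d, u (d + k) = supO u d := by
    intro d
    induction d using Nat.strong_induction_on with
    | _ d ih =>
      rcases Nat.eq_zero_or_pos d with rfl | hd
      · rw [h0, Nat.zero_add, hk]
      · cases hv : u (d + k) with
        | true => exact (lexSupSeq_eq_true (S := orbit u) (v := fun i => u (i + k)) ⟨k, rfl⟩ ih hv).symm
        | false => simpa using (hcon d hd).symm
  apply hcon (l - k) (by omega)
  rw [← hagree, Nat.sub_add_cancel hkl.le, hl]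

theorem infO_lexLe_tail_supO (u : ℕ → Bool) : lexLe (infO u) fun i => supO u (i + 1) := by
  by_cases heq : infO u = fun i => supO u (i + 1)
  · exact Or.inr heq
  left
  have hne : ∃ n, infO u n ≠ supO u (n + 1) := by
    by_contra! h
    exact heq (funext h)
  classical
  have hmin : ∀ i, i < Nat.find hne → infO u i = supO u (i + 1) := fun i hi => by
    simpa using Nat.find_min hne hi
  have hn := Nat.find_spec hne
  generalize Nat.find hne = n at hmin hn
  refine ⟨n, hmin, ?_⟩
  cases hs : supO u (n + 1) with
  | true =>
    rw [hs, ne_eq, Bool.not_eq_true] at hn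
    show infO u n < supO u (n + 1)
    rw [hs, hn]
    decide
  | false =>
    exfalso
    obtain ⟨v, ⟨k, rfl⟩, hv⟩ :=
      exists_mem_prefix_lexSupSeq (S := orbit u) ⟨_, 0, rfl⟩ (n + 2)
    apply hn
    rw [hs]
    refine lexInfSeq_eq_false (S := orbit u) (v := fun i => u (i + (k + 1))) ⟨k + 1, rfl⟩ (fun i hi => ?_) ?_
    · refine Eq.trans ?_ ((hv (i + 1) (by omega)).trans (hmin i hi).symm)
      exact congrArg u (by omega)
    · refine Eq.trans ?_ ((hv (n + 1) (by omega)).trans hs)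
      exact congrArg u (by omega)

theorem piB_two_le_of_lexLe {u v : ℕ → Bool} (h : lexLe u v) : piB 2 u ≤ piB 2 v := by
  rcases h with ⟨n, hlt, hn⟩ | rfl
  swap
  · exact le_rfl
  have hun : u n = false := by revert hn; cases u n <;> simp
  have hvn : v n = true := by revert hn; cases v n <;> simp
  have hd := ((summable_piB_terms one_lt_two v).hasSum.sub
    (summable_piB_terms one_lt_two u).hasSum).tendsto_sum_nat
  refine sub_nonneg.1 (ge_of_tendsto' hd fun N => ?_)
  have key : ∀ N, 0 ≤ ∑ k ∈ Finset.range N, ((if v k then (1 : ℝ) else 0) / 2 ^ (k + 1) -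
      (if u k then (1 : ℝ) else 0) / 2 ^ (k + 1)) ∧ (n < N → (1 / 2 : ℝ) ^ N ≤
      ∑ k ∈ Finset.range N, ((if v k then (1 : ℝ) else 0) / 2 ^ (k + 1) -
      (if u k then (1 : ℝ) else 0) / 2 ^ (k + 1))) := by
    intro N
    induction N with
    | zero => simp
    | succ N ih =>
      rw [Finset.sum_range_succ]
      have hp : (0 : ℝ) < (1 / 2) ^ (N + 1) := by positivity
      have he : (1 : ℝ) / 2 ^ (N + 1) = (1 / 2) ^ (N + 1) := (one_div_pow _ _).symm
      rcases lt_trichotomy N n with hN | rfl | hN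
      · rw [hlt N hN, sub_self, add_zero]
        exact ⟨ih.1, fun h => by omega⟩
      · rw [hun, hvn]
        simp only [if_true, Bool.false_eq_true, if_false, zero_div, sub_zero, he]
        exact ⟨by linarith [ih.1], fun _ => by linarith [ih.1]⟩
      · have h1 := ih.2 hN
        have h2 : (1 / 2 : ℝ) ^ N = 2 * (1 / 2) ^ (N + 1) := by rw [pow_succ]; ring
        have h3 : -(1 / 2 : ℝ) ^ (N + 1) ≤ (if v N then (1 : ℝ) else 0) / 2 ^ (N + 1) -
            (if u N then (1 : ℝ) else 0) / 2 ^ (N + 1) := by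
          split_ifs <;> simp only [zero_div, he] <;> linarith
        exact ⟨by linarith, fun _ => by linarith⟩
  exact (key N).1

theorem two_mul_piB_two (v : ℕ → Bool) (h0 : v 0 = true) :
    2 * piB 2 v = 1 + piB 2 fun i => v (i + 1) := by
  have h := (summable_piB_terms one_lt_two v).tsum_eq_zero_add
  have h' : piB 2 v = 1 / 2 + (1 / 2) * piB 2 fun i => v (i + 1) := by
    unfold piB
    rw [h, ← tsum_mul_left]
    congr 1
    · simp [h0]
    · refine tsum_congr fun k => ?_
      rw [pow_succ _ (k + 1)]
      field_simp
  rw [h']; ring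

/-- The chord bound for the convex function `β ↦ β⁻ⁿ` on `[1, 2]`. -/
theorem inv_pow_le_chord {β : ℝ} (h1 : 1 ≤ β) (h2 : β ≤ 2) (n : ℕ) :
    (1 / β) ^ n ≤ (2 - β) + (β - 1) * (1 / 2) ^ n := by
  induction n with
  | zero => norm_num
  | succ n ih =>
    have hβ : 0 < β := by linarith
    have hp : (1 / 2 : ℝ) ^ n ≤ 1 := pow_le_one₀ (by norm_num) (by norm_num)
    rw [pow_succ, pow_succ, mul_one_div, div_le_iff₀ hβ]
    refine ih.trans ?_
    nlinarith [mul_nonneg (mul_nonneg (sub_nonneg.2 h1) (sub_nonneg.2 h2))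
      (by linarith : 0 ≤ 1 - (1 / 2 : ℝ) ^ n / 2)]

theorem sub_one_mul_one_add_piB_le {β : ℝ} (h1 : 1 < β) (h2 : β ≤ 2) (w : ℕ → Bool) :
    (β - 1) * (1 + piB β w) ≤ 1 + piB 2 w := by
  have hβ : 0 < β := by linarith
  set d : ℕ → ℝ := fun k => (β - 1) * (1 / β ^ (k + 1)) - 1 / 2 ^ (k + 1) with hd
  have hsum : HasSum (fun k => (if w k then (1 : ℝ) else 0) * d k)
      ((β - 1) * piB β w - piB 2 w) := by
    have h := ((summable_piB_terms h1 w).hasSum.mul_left (β - 1)).sub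
      (summable_piB_terms one_lt_two w).hasSum
    have hfun : (fun k => (if w k then (1 : ℝ) else 0) * d k) = fun k =>
        (β - 1) * ((if w k then (1 : ℝ) else 0) / β ^ (k + 1)) -
          (if w k then (1 : ℝ) else 0) / 2 ^ (k + 1) := by
      funext k
      simp only [hd]
      split_ifs <;> simp
    rw [hfun]
    exact h
  have htel : ∀ k, d k = ((1 / β) ^ k - (1 / 2) ^ k) - ((1 / β) ^ (k + 1) - (1 / 2) ^ (k + 1)) := by
    intro k
    simp only [hd, one_div_pow, pow_succ]
    field_simp
    ring
  have hdneg : ∀ k, d (k + 1) ≤ 0 → d k ≤ 0 := by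
    intro k hk
    have e : 2 * d (k + 1) = d k + (2 / β - 1) * ((β - 1) * (1 / β ^ (k + 1))) := by
      simp only [hd, pow_succ]
      field_simp
      ring
    have h3 : 0 ≤ (2 / β - 1) * ((β - 1) * (1 / β ^ (k + 1))) := by
      have : 0 ≤ 2 / β - 1 := sub_nonneg.2 ((one_le_div hβ).2 h2)
      have : 0 ≤ β - 1 := by linarith
      positivity
    linarith
  have hF : ∀ n, (1 / β) ^ n - (1 / 2) ^ n ≤ 2 - β := by
    intro n
    have hp : (0 : ℝ) ≤ (1 / 2) ^ n := by positivity
    nlinarith [inv_pow_le_chord h1.le h2 n, mul_nonneg (sub_nonneg.2 h2) hp]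
  have hF0 : ∀ n, 0 ≤ (1 / β) ^ n - (1 / 2 : ℝ) ^ n := by
    intro n
    have : (1 / 2 : ℝ) ≤ 1 / β := one_div_le_one_div_of_le hβ h2
    exact sub_nonneg.2 (by gcongr)
  have hneg : ∀ n, d n ≤ 0 → ∀ k, k ≤ n → d k ≤ 0 := by
    intro n
    induction n with
    | zero => intro h k hk; rwa [Nat.le_zero.1 hk]
    | succ n ih =>
      intro h k hk
      rcases Nat.le_succ_iff.1 hk with hk | rfl
      · exact ih (hdneg n h) k hk
      · exact h
  have hpart : ∀ n, ∑ k ∈ Finset.range n, (if w k then (1 : ℝ) else 0) * d k ≤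
      (2 - β) - ((1 / β) ^ n - (1 / 2) ^ n) := by
    intro n
    induction n with
    | zero => simpa using h2
    | succ n ih =>
      rcases le_total (d n) 0 with hn | hn
      · refine (Finset.sum_nonpos fun k hk => ?_).trans (sub_nonneg.2 (hF _))
        have := hneg n hn k (Nat.lt_succ_iff.1 (Finset.mem_range.1 hk))
        split_ifs <;> simp [this]
      · rw [Finset.sum_range_succ]
        have h4 : (if w n then (1 : ℝ) else 0) * d n ≤ d n := by split_ifs <;> simp [hn]
        linarith [htel n]
  have := le_of_tendsto' hsum.tendsto_sum_nat fun n => (hpart n).trans (sub_le_self _ (hF0 n))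
  linarith

theorem mul_piB_strictAnti {v : ℕ → Bool} (hv : ∃ j, 0 < j ∧ v j = true) {β γ : ℝ}
    (h1 : 1 ≤ β) (hβγ : β < γ) (hs : Summable fun k : ℕ => (if v k then (1 : ℝ) else 0) / β ^ (k + 1)) :
    γ * piB γ v < β * piB β v := by
  obtain ⟨j, hj, hvj⟩ := hv
  have hβ : 0 < β := by linarith
  have hγ : 0 < γ := by linarith
  have e : ∀ x : ℝ, 0 < x → ∀ k, x * ((if v k then (1 : ℝ) else 0) / x ^ (k + 1)) =
      (if v k then (1 : ℝ) else 0) / x ^ k := by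
    intro x hx k
    rw [pow_succ]
    field_simp
  unfold piB
  rw [← tsum_mul_left, ← tsum_mul_left]
  refine Summable.tsum_lt_tsum (i := j) (fun k => ?_) ?_
    ((summable_piB_terms (by linarith) v).mul_left γ) (hs.mul_left β)
  · rw [e γ hγ, e β hβ]
    gcongr
  · rw [e γ hγ, e β hβ, hvj, if_pos rfl]
    exact one_div_lt_one_div_of_lt (by positivity) (pow_lt_pow_left₀ hβγ hβ.le hj.ne')

theorem two_le_fVal {m : ℝ} (hm : m ∈ Set.Ioc (1 : ℝ) 2) {u : ℕ → Bool} (hu : TwoOnes u)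
    (h : m ≤ 2 * piB 2 (supO u)) : 2 ≤ fVal u m := by
  obtain ⟨hm1, hm2⟩ := hm
  have hm0 : 0 < m - 1 := by linarith
  refine le_csInf ?_ ?_
  · have hB : 2 ≤ m / (m - 1) := by rw [le_div_iff₀ hm0]; linarith
    have hcont : ContinuousOn (fun β => β * piB β (supO u)) (Set.Icc 2 (m / (m - 1))) :=
      (continuousOn_id.mul (continuousOn_piB _)).mono Set.Icc_subset_Ici_self
    have hend : m / (m - 1) * piB (m / (m - 1)) (supO u) ≤ m := by
      calc m / (m - 1) * piB (m / (m - 1)) (supO u)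
          ≤ m / (m - 1) * (1 / (m / (m - 1) - 1)) :=
            mul_le_mul_of_nonneg_left (piB_le (by linarith) _) (by linarith)
        _ = m := by
            have e : m / (m - 1) - 1 = 1 / (m - 1) := by field_simp; ring
            rw [e]
            field_simp
    obtain ⟨β, hβ, hβm⟩ := intermediate_value_Icc' hB hcont ⟨hend, h⟩
    exact ⟨β, by linarith [hβ.1], hβm⟩
  · rintro β ⟨hβ, hβm⟩
    by_contra! hlt
    by_cases hs : Summable fun k : ℕ => (if supO u k then (1 : ℝ) else 0) / β ^ (k + 1)
    · linarith [mul_piB_strictAnti (exists_pos_supO hu) hβ hlt hs]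
    · rw [piB, tsum_eq_zero_of_not_summable hs] at hβm
      linarith

theorem two_le_gVal {m : ℝ} (hm : m ≤ 2) {u : ℕ → Bool} (h : 1 + piB 2 (infO u) < m) :
    2 ≤ gVal u m := by
  refine le_csInf ?_ ?_
  · have hcont : ContinuousOn (fun β => (β - 1) * (1 + piB β (infO u))) (Set.Icc 2 3) :=
      ((continuousOn_id.sub continuousOn_const).mul
        (continuousOn_const.add (continuousOn_piB _))).mono Set.Icc_subset_Ici_self
    have h3 := piB_nonneg (β := 3) (by norm_num) (infO u)
    obtain ⟨β, hβ, hβm⟩ := intermediate_value_Icc (by norm_num) hcont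
      (show m ∈ Set.Icc _ _ from ⟨by norm_num; linarith, by norm_num; linarith⟩)
    exact ⟨β, by linarith [hβ.1], hβm⟩
  · rintro β ⟨hβ, hβm⟩
    by_contra! hlt
    linarith [sub_one_mul_one_add_piB_le hβ hlt.le (infO u)]

/-- `max (f_u(m), g_u(m)) ≥ 2` for every `u` with at least two ones. -/
theorem max_f_g_ge_two (m : ℝ) (hm : m ∈ Set.Ioc (1 : ℝ) 2) (u : ℕ → Bool) (hu : TwoOnes u) :
    2 ≤ max (fVal u m) (gVal u m) := by
  rcases le_or_gt m (2 * piB 2 (supO u)) with h | h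
  · exact le_max_of_le_left (two_le_fVal hm hu h)
  · refine le_max_of_le_right (two_le_gVal hm.2 (lt_of_le_of_lt ?_ h))
    rw [two_mul_piB_two _ (supO_zero hu)]
    linarith [piB_two_le_of_lexLe (infO_lexLe_tail_supO u)]
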